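/- arXiv:2406.09943 — 10 statements merged into one kernel-verified Lean document; each statement's English description precedes it below -/
import Mathlib

section
/- Let X ⊆ ℝ^m be a compact algebraic set, i.e., X is compact and X is the common zero set of a family of polynomials with real coefficients in m variables. Let f : ℝⁿ → ℝ^m be a polynomial map and let K ⊆ ℝⁿ be a compact set with non-empty interior such that f(K) ⊆ X. Then f(K) is a singleton contained in X, i.e., there exists y ∈ X with f(K) = {y}. -/
/-- A compact algebraic set `X ⊆ ℝ^m` cannot contain the image of a compact
set `K ⊆ ℝⁿ` with non-empty interior under a polynomial map, except as a singleton. -/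
theorem compact_algebraic_image_singleton
    (n m : ℕ) (X : Set (Fin m → ℝ))
    (hXcomp : IsCompact X)
    (hXalg : ∃ Ps : Set (MvPolynomial (Fin m) ℝ),
      X = {y | ∀ p ∈ Ps, MvPolynomial.eval y p = 0})
    (f : (Fin n → ℝ) → (Fin m → ℝ))
    (hf : ∃ F : Fin m → MvPolynomial (Fin n) ℝ,
      ∀ x i, f x i = MvPolynomial.eval x (F i))
    (K : Set (Fin n → ℝ)) (hKcomp : IsCompact K)
    (hKint : (interior K).Nonempty)
    (hfK : f '' K ⊆ X) :
    ∃ y ∈ X, f '' K = {y} := by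
  obtain ⟨Ps, hPs⟩ := hXalg
  obtain ⟨F, hF⟩ := hf
  obtain ⟨a, ha⟩ := hKint
  have haK : a ∈ K := interior_subset ha
  obtain ⟨ε, hε, hball⟩ := Metric.isOpen_iff.1 isOpen_interior a ha
  have hfx : ∀ x, f x = fun i => MvPolynomial.eval x (F i) := fun x => funext (hF x)
  have hall : ∀ x, f x ∈ X := by
    intro x
    rw [hPs]
    intro p hp
    have hev : ∀ z, MvPolynomial.eval z (MvPolynomial.bind₁ F p)
        = MvPolynomial.eval (f z) p := by
      intro z
      rw [hfx, MvPolynomial.eval, MvPolynomial.eval₂Hom_bind₁]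
      rfl
    have hz : MvPolynomial.bind₁ F p = 0 := by
      apply MvPolynomial.funext_set (fun i => Metric.ball (a i) ε)
      · intro i
        rw [Real.ball_eq_Ioo]
        exact Set.Ioo_infinite (by linarith)
      · intro z hz
        have hzK : z ∈ K := by
          apply interior_subset
          apply hball
          rw [ball_pi _ hε]
          exact hz
        have h1 : f z ∈ X := hfK ⟨z, hzK, rfl⟩
        rw [hPs] at h1
        rw [hev, h1 p hp, map_zero]
    rw [← hev, hz, map_zero]
  have hconst : ∀ x, f x = f a := by
    intro x
    funext i
    obtain ⟨C, hC⟩ := hXcomp.isBounded.exists_norm_le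
    let P : Polynomial ℝ := MvPolynomial.aeval
      (fun j => Polynomial.C (a j) + Polynomial.X * Polynomial.C (x j - a j)) (F i)
    have hP : ∀ t : ℝ, P.eval t = f (fun j => a j + t * (x j - a j)) i := by
      intro t
      simp only [P]
      rw [hF, ← Polynomial.coe_evalRingHom, MvPolynomial.aeval_def, MvPolynomial.hom_eval₂]
      change _ = MvPolynomial.eval₂ (RingHom.id ℝ) _ (F i)
      congr 1
      · ext; simp
      · funext j; simp
    have hdeg : P.degree ≤ 0 := by
      by_contra hd
      have ht := P.abs_tendsto_atTop (not_le.1 hd)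
      obtain ⟨t, ht⟩ := (ht.eventually_gt_atTop C).exists
      rw [hP] at ht
      have h2 := (norm_le_pi_norm (f (fun j => a j + t * (x j - a j))) i).trans (hC _ (hall _))
      rw [Real.norm_eq_abs] at h2
      linarith
    have h0 := hP 0
    have h1 := hP 1
    rw [Polynomial.eq_C_of_degree_le_zero hdeg, Polynomial.eval_C] at h0 h1
    simp only [zero_mul, add_zero, one_mul, add_sub_cancel] at h0 h1
    exact h1.symm.trans h0
  refine ⟨f a, hall a, ?_⟩
  ext y
  constructor
  · rintro ⟨x, -, rfl⟩
    exact hconst x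
  · rintro rfl
    exact ⟨a, haK, rfl⟩
end

section
/- For every n ≥ 1 and m ≥ 1 there is no polynomial map f : ℝⁿ → ℝ^{m+1} such that f(B̄_n) = 𝕊^m. That is, a sphere cannot be the image of a closed ball under a polynomial map. -/
/-- A sphere `𝕊^m` is never the image of a closed unit ball `B̄_n` under a
polynomial map. -/
theorem sphere_not_polynomial_image_of_closedBall
    (n m : ℕ) (hn : 1 ≤ n) (hm : 1 ≤ m) :
    ¬ ∃ f : EuclideanSpace ℝ (Fin n) → EuclideanSpace ℝ (Fin (m + 1)),
      (∃ F : Fin (m + 1) → MvPolynomial (Fin n) ℝ,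
        ∀ x i, f x i = MvPolynomial.eval x (F i)) ∧
      f '' Metric.closedBall (0 : EuclideanSpace ℝ (Fin n)) 1 =
        Metric.sphere (0 : EuclideanSpace ℝ (Fin (m + 1))) 1 := by
  rintro ⟨f, ⟨F, hF⟩, him⟩
  have hsq : ∀ x ∈ Metric.closedBall (0 : EuclideanSpace ℝ (Fin n)) 1,
      ∑ i, (f x i) ^ 2 = 1 := by
    intro x hx
    have h : f x ∈ Metric.sphere (0 : EuclideanSpace ℝ (Fin (m + 1))) 1 := by
      rw [← him]; exact ⟨x, hx, rfl⟩
    rw [mem_sphere_zero_iff_norm] at h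
    have h2 := EuclideanSpace.real_norm_sq_eq (f x)
    rw [h] at h2
    linarith
  have hconst : ∀ x ∈ Metric.closedBall (0 : EuclideanSpace ℝ (Fin n)) 1, f x = f 0 := by
    intro x hx
    let q : Fin (m + 1) → Polynomial ℝ := fun i =>
      MvPolynomial.eval₂Hom Polynomial.C (fun j => Polynomial.C (x j) * Polynomial.X) (F i)
    have hq : ∀ i t, (q i).eval t = f (t • x) i := by
      intro i t
      rw [hF]
      change (Polynomial.evalRingHom t) (MvPolynomial.eval₂Hom _ _ (F i)) = _
      rw [MvPolynomial.map_eval₂Hom]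
      have h1 : (Polynomial.evalRingHom t).comp Polynomial.C = RingHom.id ℝ := by
        ext; simp
      rw [h1]
      change MvPolynomial.eval₂ _ _ _ = MvPolynomial.eval₂ _ _ _
      congr 1
      funext j
      simp only [Polynomial.coe_evalRingHom, Polynomial.eval_mul, Polynomial.eval_C,
        Polynomial.eval_X, PiLp.smul_apply, smul_eq_mul]
      exact mul_comm _ _
    have hs : ∑ i, (q i) ^ 2 = 1 := by
      apply Polynomial.eq_of_infinite_eval_eq
      refine (Set.Icc_infinite (zero_lt_one' ℝ)).mono ?_
      intro t ht
      simp only [Set.mem_ofPred_eq, Polynomial.eval_finsetSum, Polynomial.eval_pow, hq,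
        Polynomial.eval_one]
      apply hsq
      rw [mem_closedBall_zero_iff] at hx ⊢
      rw [norm_smul, Real.norm_of_nonneg ht.1]
      exact mul_le_one₀ ht.2 (norm_nonneg _) hx
    have hb : ∀ i t, |(q i).eval t| ≤ 1 := by
      intro i t
      rw [← sq_le_one_iff_abs_le_one]
      have h := congrArg (Polynomial.eval t) hs
      simp only [Polynomial.eval_finsetSum, Polynomial.eval_pow, Polynomial.eval_one] at h
      rw [← h]
      exact Finset.single_le_sum (f := fun i => (Polynomial.eval t (q i)) ^ 2)
        (fun _ _ => sq_nonneg _) (Finset.mem_univ i)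
    ext i
    have hd : (q i).degree ≤ 0 :=
      (Polynomial.isBoundedUnder_abs_atTop_iff (q i)).1
        (Filter.isBoundedUnder_of ⟨1, hb i⟩)
    have hc := Polynomial.eq_C_of_degree_le_zero hd
    have h1 := hq i 1
    have h0 := hq i 0
    rw [hc, Polynomial.eval_C] at h0 h1
    rw [one_smul] at h1
    rw [zero_smul] at h0
    rw [← h1, h0]
  have hall : ∀ y ∈ Metric.sphere (0 : EuclideanSpace ℝ (Fin (m + 1))) 1, y = f 0 := by
    intro y hy
    rw [← him] at hy
    obtain ⟨x, hx, rfl⟩ := hy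
    exact hconst x hx
  have h1 := hall (EuclideanSpace.single 0 1) (by simp)
  have h2 := hall (-EuclideanSpace.single 0 1) (by simp)
  have h3 := congrArg (fun v : EuclideanSpace ℝ (Fin (m + 1)) => v 0) (h1.trans h2.symm)
  norm_num at h3
end

section
/- Let k ≥ 2 and let f : ℝ^{k+1} → ℝ² be a polynomial map such that f(x) lies on the unit circle 𝕊¹ for every x in the unit sphere 𝕊^k ⊆ ℝ^{k+1}. Then f is constant on 𝕊^k, i.e., there exists c ∈ 𝕊¹ with f(x) = c for all x ∈ 𝕊^k. -/
open Complex in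
lemma trig_poly {σ : Type*} (F : MvPolynomial σ ℝ) (x v : σ → ℝ) :
    ∃ (d : ℕ) (P : Polynomial ℂ), ∀ θ : ℝ,
      ((MvPolynomial.eval (fun i => Real.cos θ * x i + Real.sin θ * v i) F : ℝ) : ℂ)
        * exp (θ * I) ^ d = P.eval (exp (θ * I)) := by
  induction F using MvPolynomial.induction_on with
  | C a => exact ⟨0, Polynomial.C (a : ℂ), fun θ => by simp⟩
  | add p q hp hq =>
    obtain ⟨d, P, hP⟩ := hp
    obtain ⟨e, Q, hQ⟩ := hq
    refine ⟨d + e, P * Polynomial.X ^ e + Q * Polynomial.X ^ d, fun θ => ?_⟩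
    simp only [map_add, Polynomial.eval_add, Polynomial.eval_mul, Polynomial.eval_pow,
      Polynomial.eval_X, ← hP, ← hQ, ofReal_add]
    ring
  | mul_X p i hp =>
    obtain ⟨d, P, hP⟩ := hp
    refine ⟨d + 1, P * (Polynomial.C ((x i : ℂ) / 2) * (Polynomial.X ^ 2 + 1)
      - Polynomial.C (I * (v i : ℂ) / 2) * (Polynomial.X ^ 2 - 1)), fun θ => ?_⟩
    simp only [map_mul, Polynomial.eval_add, Polynomial.eval_mul, Polynomial.eval_pow,
      Polynomial.eval_X, Polynomial.eval_sub, Polynomial.eval_one, Polynomial.eval_C, ← hP,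
      MvPolynomial.eval_X, ofReal_add, ofReal_mul, ofReal_cos, ofReal_sin]
    have h1 : Complex.cos θ ^ 2 + Complex.sin θ ^ 2 = 1 := by
      rw [add_comm]; exact Complex.sin_sq_add_cos_sq _
    have h2 : exp (θ * I) ^ 2 + 1 = 2 * exp (θ * I) * Complex.cos θ := by
      rw [exp_mul_I]
      linear_combination Complex.sin θ ^ 2 * I_sq - h1
    have h3 : exp (θ * I) ^ 2 - 1 = 2 * I * exp (θ * I) * Complex.sin θ := by
      rw [exp_mul_I]
      linear_combination h1 - Complex.sin θ ^ 2 * I_sq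
    rw [h2, h3]
    linear_combination (1 : ℂ) * (MvPolynomial.eval (fun i => Real.cos θ * x i + Real.sin θ * v i) p : ℝ)
      * exp (θ * I) ^ (d + 1) * v i * Complex.sin θ * I_sq

open Complex in
/-- A polynomial map of a great circle to the unit circle is `c * exp (i m θ)`. -/
lemma circle_map {σ : Type*} (F G : MvPolynomial σ ℝ) (x v : σ → ℝ)
    (h : ∀ θ : ℝ, (MvPolynomial.eval (fun i => Real.cos θ * x i + Real.sin θ * v i) F) ^ 2
      + (MvPolynomial.eval (fun i => Real.cos θ * x i + Real.sin θ * v i) G) ^ 2 = 1) :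
    ∃ (c : ℂ) (m : ℤ), ∀ θ : ℝ,
      ((MvPolynomial.eval (fun i => Real.cos θ * x i + Real.sin θ * v i) F : ℝ) : ℂ)
      + ((MvPolynomial.eval (fun i => Real.cos θ * x i + Real.sin θ * v i) G : ℝ) : ℂ) * I
      = c * exp (m * (θ * I)) := by
  obtain ⟨d, P, hP⟩ := trig_poly F x v
  obtain ⟨e, Q, hQ⟩ := trig_poly G x v
  set A : Polynomial ℂ := P * Polynomial.X ^ e + Polynomial.C I * Q * Polynomial.X ^ d with hA
  set B : Polynomial ℂ := P * Polynomial.X ^ e - Polynomial.C I * Q * Polynomial.X ^ d with hB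
  have key : A * B = Polynomial.X ^ (2 * (d + e)) := by
    apply Polynomial.eq_of_infinite_eval_eq
    have hinf : (Set.range (fun θ : ℝ => exp (θ * I))).Infinite := by
      refine Set.Infinite.mono (s := (fun θ : ℝ => exp (θ * I)) '' Set.Ioo 0 1) ?_ ?_
      · exact Set.image_subset_range _ _
      · refine (Set.Ioo_infinite (by norm_num)).image ?_
        intro a ha b hb hab
        have hr := congrArg Complex.re hab
        simp only [exp_ofReal_mul_I_re] at hr
        have hpi := Real.pi_gt_three
        exact Real.injOn_cos ⟨ha.1.le, by linarith [ha.2]⟩ ⟨hb.1.le, by linarith [hb.2]⟩ hr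
    refine hinf.mono ?_
    rintro _ ⟨θ, rfl⟩
    have hθ : ((MvPolynomial.eval (fun i => Real.cos θ * x i + Real.sin θ * v i) F : ℝ) : ℂ) ^ 2
      + ((MvPolynomial.eval (fun i => Real.cos θ * x i + Real.sin θ * v i) G : ℝ) : ℂ) ^ 2 = 1 := by
      exact_mod_cast h θ
    simp only [Set.mem_ofPred_eq, hA, hB, Polynomial.eval_add, Polynomial.eval_mul,
      Polynomial.eval_pow, Polynomial.eval_X, Polynomial.eval_sub, Polynomial.eval_C, ← hP, ← hQ]
    generalize ((MvPolynomial.eval (fun i => Real.cos θ * x i + Real.sin θ * v i) F : ℝ) : ℂ) = f at *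
    generalize ((MvPolynomial.eval (fun i => Real.cos θ * x i + Real.sin θ * v i) G : ℝ) : ℂ) = g at *
    linear_combination (exp (θ * I)) ^ (2 * (d + e)) * hθ
      - (exp (θ * I)) ^ (2 * (d + e)) * g ^ 2 * I_sq
  obtain ⟨j, -, hj⟩ := (dvd_prime_pow Polynomial.prime_X _).1 (Dvd.intro _ key)
  obtain ⟨u, hu⟩ := hj.symm
  obtain ⟨c, -, hc⟩ := Polynomial.isUnit_iff.1 u.isUnit
  refine ⟨c, (j : ℤ) - ((d + e : ℕ) : ℤ), fun θ => ?_⟩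
  have h1 : A.eval (exp (θ * I)) = exp (θ * I) ^ j * c := by
    rw [← hu, ← hc, Polynomial.eval_mul, Polynomial.eval_pow, Polynomial.eval_X, Polynomial.eval_C]
  simp only [hA, Polynomial.eval_add, Polynomial.eval_mul,
      Polynomial.eval_pow, Polynomial.eval_X, Polynomial.eval_C, ← hP, ← hQ] at h1
  rw [exp_int_mul, zpow_sub₀ (exp_ne_zero _), zpow_natCast, zpow_natCast, mul_div_assoc', eq_div_iff
    (pow_ne_zero _ (exp_ne_zero _))]
  linear_combination h1

/-- For `k ≥ 2`, every polynomial map `f : ℝ^{k+1} → ℝ²` mapping the unit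
sphere `𝕊^k` into the unit circle `𝕊¹` is constant on `𝕊^k`. -/
theorem polynomial_map_sphere_to_circle_constant
    (k : ℕ) (hk : 2 ≤ k)
    (f : EuclideanSpace ℝ (Fin (k + 1)) → ℝ × ℝ)
    (hf : ∃ F₁ F₂ : MvPolynomial (Fin (k + 1)) ℝ,
      ∀ x, f x = (MvPolynomial.eval x F₁, MvPolynomial.eval x F₂))
    (hsphere : ∀ x ∈ Metric.sphere (0 : EuclideanSpace ℝ (Fin (k + 1))) 1,
      (f x).1 ^ 2 + (f x).2 ^ 2 = 1) :
    ∃ c : ℝ × ℝ, c.1 ^ 2 + c.2 ^ 2 = 1 ∧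
      ∀ x ∈ Metric.sphere (0 : EuclideanSpace ℝ (Fin (k + 1))) 1, f x = c := by
  obtain ⟨F, G, hFG⟩ := hf
  have perp : ∀ x y : EuclideanSpace ℝ (Fin (k + 1)), ∃ v : EuclideanSpace ℝ (Fin (k + 1)),
      ‖v‖ = 1 ∧ inner ℝ x v = 0 ∧ inner ℝ y v = 0 := by
    intro x y
    set S := Submodule.span ℝ ({x, y} : Set (EuclideanSpace ℝ (Fin (k + 1)))) with hS
    have h1 : Module.finrank ℝ S ≤ 2 := by
      have := finrank_span_finset_le_card (R := ℝ) ({x, y} : Finset (EuclideanSpace ℝ (Fin (k + 1))))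
      have h2 := Finset.card_le_two (a := x) (b := y)
      rw [Finset.coe_pair] at this
      exact this.trans h2
    have h2 := S.finrank_add_finrank_orthogonal
    rw [finrank_euclideanSpace_fin] at h2
    have h3 : 0 < Module.finrank ℝ Sᗮ := by omega
    have : Nontrivial Sᗮ := Module.finrank_pos_iff.1 h3
    obtain ⟨w, hw⟩ := exists_norm_eq (Sᗮ) (zero_le_one (α := ℝ))
    refine ⟨w, hw, ?_, ?_⟩
    · exact (Submodule.mem_orthogonal S _).1 w.2 x (Submodule.subset_span (by simp))
    · exact (Submodule.mem_orthogonal S _).1 w.2 y (Submodule.subset_span (by simp))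
  have onS : ∀ x v : EuclideanSpace ℝ (Fin (k + 1)), ‖x‖ = 1 → ‖v‖ = 1 → inner ℝ x v = 0 →
      ∀ θ : ℝ, ‖Real.cos θ • x + Real.sin θ • v‖ = 1 := by
    intro x v hx hv hxv θ
    have : ‖Real.cos θ • x + Real.sin θ • v‖ ^ 2 = 1 := by
      rw [norm_add_sq_real, norm_smul, norm_smul, inner_smul_left, inner_smul_right, hxv, hx, hv]
      simp
    nlinarith [norm_nonneg (Real.cos θ • x + Real.sin θ • v)]
  set H : EuclideanSpace ℝ (Fin (k + 1)) → ℂ := fun x => ((f x).1 : ℂ) + (f x).2 * Complex.I with hH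
  have circ : ∀ x v : EuclideanSpace ℝ (Fin (k + 1)), ‖x‖ = 1 → ‖v‖ = 1 → inner ℝ x v = 0 →
      ∃ (c : ℂ) (m : ℤ), ∀ θ : ℝ, H (Real.cos θ • x + Real.sin θ • v)
        = c * Complex.exp (m * (θ * Complex.I)) := by
    intro x v hx hv hxv
    have hcoe : ∀ θ : ℝ, (fun i => Real.cos θ * x i + Real.sin θ * v i) =
        ⇑(Real.cos θ • x + Real.sin θ • v) := fun θ => by ext i; simp
    obtain ⟨c, m, h⟩ := circle_map F G x v (fun θ => by
      have := hsphere (Real.cos θ • x + Real.sin θ • v) (by simpa using onS x v hx hv hxv θ)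
      rw [hFG] at this
      rw [hcoe]; exact this)
    refine ⟨c, m, fun θ => ?_⟩
    rw [← h θ, hcoe]
    simp only [hH, hFG]
  have four_perp : ∀ x v : EuclideanSpace ℝ (Fin (k + 1)), ‖x‖ = 1 → ‖v‖ = 1 → inner ℝ x v = 0 →
      H x ^ 4 = H v ^ 4 := by
    intro x v hx hv hxv
    obtain ⟨c, m, h⟩ := circ x v hx hv hxv
    have h0 := h 0
    have h1 := h (Real.pi / 2)
    simp only [Real.cos_zero, Real.sin_zero, one_smul, zero_smul, add_zero, Complex.ofReal_zero,
      zero_mul, mul_zero, Complex.exp_zero, mul_one] at h0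
    simp only [Real.cos_pi_div_two, Real.sin_pi_div_two, one_smul, zero_smul, zero_add] at h1
    rw [h0, h1, mul_pow, ← Complex.exp_nat_mul]
    have : ((4 : ℕ) : ℂ) * (m * (((Real.pi / 2 : ℝ) : ℂ) * Complex.I))
        = m * (2 * Real.pi * Complex.I) := by push_cast; ring
    rw [this, Complex.exp_int_mul_two_pi_mul_I, mul_one]
  have four : ∀ x y : EuclideanSpace ℝ (Fin (k + 1)), ‖x‖ = 1 → ‖y‖ = 1 → H x ^ 4 = H y ^ 4 := by
    intro x y hx hy
    obtain ⟨v, hv, h1, h2⟩ := perp x y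
    rw [four_perp x v hx hv h1, four_perp y v hy hv h2]
  have Hne : ∀ x, ‖x‖ = 1 → H x ≠ 0 := by
    intro x hx h0
    have h1 := hsphere x (by simpa using hx)
    have hr : (f x).1 = 0 := by simpa [hH] using congrArg Complex.re h0
    have hi : (f x).2 = 0 := by simpa [hH] using congrArg Complex.im h0
    rw [hr, hi] at h1
    norm_num at h1
  have eq_perp : ∀ x v : EuclideanSpace ℝ (Fin (k + 1)), ‖x‖ = 1 → ‖v‖ = 1 → inner ℝ x v = 0 →
      H x = H v := by
    intro x v hx hv hxv
    obtain ⟨c, m, h⟩ := circ x v hx hv hxv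
    have h0 := h 0
    have h1 := h (Real.pi / 2)
    simp only [Real.cos_zero, Real.sin_zero, one_smul, zero_smul, add_zero, Complex.ofReal_zero,
      zero_mul, mul_zero, Complex.exp_zero, mul_one] at h0
    simp only [Real.cos_pi_div_two, Real.sin_pi_div_two, one_smul, zero_smul, zero_add] at h1
    by_cases hm : m = 0
    · rw [h0, h1, hm]; simp
    · exfalso
      have h2 := h (Real.pi / (4 * m))
      have h3 := four x _ hx (onS x v hx hv hxv (Real.pi / (4 * m)))
      rw [h2, mul_pow, ← Complex.exp_nat_mul, ← h0] at h3
      have hmc : (m : ℂ) ≠ 0 := by exact_mod_cast hm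
      have : ((4 : ℕ) : ℂ) * (m * (((Real.pi / (4 * m) : ℝ) : ℂ) * Complex.I))
          = Real.pi * Complex.I := by push_cast; field_simp
      rw [this, Complex.exp_pi_mul_I] at h3
      have h4 : H x ^ 4 = 0 := by linear_combination h3 / 2
      exact Hne x hx (pow_eq_zero_iff (by norm_num) |>.1 h4)
  obtain ⟨x₀, hx₀, -, -⟩ := perp 0 0
  refine ⟨f x₀, hsphere x₀ (by simpa using hx₀), fun x hx => ?_⟩
  have hx1 : ‖x‖ = 1 := by simpa using hx
  obtain ⟨v, hv, h1, h2⟩ := perp x x₀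
  have h3 : H x = H x₀ := by rw [eq_perp x v hx1 hv h1, eq_perp x₀ v hx₀ hv h2]
  have hr := congrArg Complex.re h3
  have hi := congrArg Complex.im h3
  simp [hH] at hr hi
  exact Prod.ext hr hi
end

section
/- A set S ⊆ ℝ^m is a regular image of the interval [−1,1] if and only if it is a regular image of the unit circle 𝕊¹. That is: there exist real polynomials p₁,…,p_m, q₁,…,q_m in one variable with each qᵢ vanishing nowhere on [−1,1] such that S = {(p₁(t)/q₁(t),…,p_m(t)/q_m(t)) : t ∈ [−1,1]} if and only if there exist real polynomials P₁,…,P_m, Q₁,…,Q_m in two variables with each Qᵢ vanishing nowhere on 𝕊¹ such that S = {(P₁(x,y)/Q₁(x,y),…,P_m(x,y)/Q_m(x,y)) : (x,y) ∈ 𝕊¹}. -/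
open Polynomial in
/-- Clearing denominators in a bivariate polynomial evaluated at rational functions. -/
lemma clear_denominators (N : Fin 2 → Polynomial ℝ) (D : Polynomial ℝ)
    (hD : ∀ t : ℝ, D.eval t ≠ 0) (P : MvPolynomial (Fin 2) ℝ) :
    ∃ (p : Polynomial ℝ) (n : ℕ), ∀ t : ℝ,
      p.eval t = (D.eval t) ^ n * MvPolynomial.eval (fun j => (N j).eval t / D.eval t) P := by
  induction P using MvPolynomial.induction_on with
  | C a => exact ⟨Polynomial.C a, 0, fun t => by simp⟩
  | add p q hp hq =>
    obtain ⟨p', n, h⟩ := hp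
    obtain ⟨q', k, h'⟩ := hq
    refine ⟨p' * D ^ k + q' * D ^ n, n + k, fun t => ?_⟩
    simp only [Polynomial.eval_add, Polynomial.eval_mul, Polynomial.eval_pow, h, h', map_add]
    ring
  | mul_X p j hp =>
    obtain ⟨p', n, h⟩ := hp
    refine ⟨p' * N j, n + 1, fun t => ?_⟩
    have := hD t
    simp only [Polynomial.eval_mul, h, map_mul, MvPolynomial.eval_X]
    field_simp
    ring

/-- Half-angle parametrization of the circle by `[-1,1]`. -/
lemma circle_param (x y : ℝ) (h : x ^ 2 + y ^ 2 = 1) :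
    ∃ t ∈ Set.Icc (-1 : ℝ) 1,
      x = ((1 - t ^ 2) ^ 2 - (2 * t) ^ 2) / (1 + t ^ 2) ^ 2 ∧
      y = (2 * (1 - t ^ 2) * (2 * t)) / (1 + t ^ 2) ^ 2 := by
  obtain ⟨a, b, ha, hab, hx, hy⟩ : ∃ a b : ℝ, 0 ≤ a ∧ a ^ 2 + b ^ 2 = 1 ∧
      x = a ^ 2 - b ^ 2 ∧ y = 2 * a * b := by
    by_cases hx : x = -1
    · refine ⟨0, 1, le_rfl, by norm_num, by rw [hx]; norm_num, ?_⟩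
      subst hx
      have : y ^ 2 = 0 := by linarith
      simpa using this
    · have h1 : -1 < x := lt_of_le_of_ne (by nlinarith [sq_nonneg y]) (Ne.symm hx)
      have hpos : 0 < (1 + x) / 2 := by linarith
      have hs := Real.sq_sqrt hpos.le
      have hs0 := Real.sqrt_pos.2 hpos
      set a := Real.sqrt ((1 + x) / 2)
      have hb : (y / (2 * a)) ^ 2 = (1 - x) / 2 := by
        rw [div_pow, mul_pow, hs, div_eq_iff (by nlinarith)]
        nlinarith
      refine ⟨a, y / (2 * a), hs0.le, by rw [hb, hs]; ring, by rw [hb, hs]; ring, ?_⟩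
      field_simp
  have ha1 : (1 + a) ≠ 0 := by linarith
  have hbb : b ^ 2 = (1 - a) * (1 + a) := by linarith
  have ht2 : (b / (1 + a)) ^ 2 = (1 - a) / (1 + a) := by
    rw [div_pow, hbb]; field_simp
  have e1 : 1 + (b / (1 + a)) ^ 2 = 2 / (1 + a) := by rw [ht2]; field_simp; ring
  have e2 : 1 - (b / (1 + a)) ^ 2 = 2 * a / (1 + a) := by rw [ht2]; field_simp; ring
  refine ⟨b / (1 + a), ⟨?_, ?_⟩, ?_, ?_⟩
  · rw [le_div_iff₀ (by linarith)]; nlinarith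
  · rw [div_le_iff₀ (by linarith)]; nlinarith
  · rw [e1, e2, hx]; field_simp
  · rw [e1, e2, hy]; field_simp

/-- A set `S ⊆ ℝ^m` is a regular image of `[-1,1]` iff it is a regular
image of the unit circle `𝕊¹`. -/
theorem regular_image_Icc_iff_regular_image_circle
    (m : ℕ) (S : Set (Fin m → ℝ)) :
    (∃ p q : Fin m → Polynomial ℝ,
      (∀ i, ∀ t ∈ Set.Icc (-1 : ℝ) 1, (q i).eval t ≠ 0) ∧
      S = {y | ∃ t ∈ Set.Icc (-1 : ℝ) 1, ∀ i, y i = (p i).eval t / (q i).eval t}) ↔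
    (∃ P Q : Fin m → MvPolynomial (Fin 2) ℝ,
      (∀ i, ∀ v : Fin 2 → ℝ, v 0 ^ 2 + v 1 ^ 2 = 1 → MvPolynomial.eval v (Q i) ≠ 0) ∧
      S = {y | ∃ v : Fin 2 → ℝ, v 0 ^ 2 + v 1 ^ 2 = 1 ∧
        ∀ i, y i = MvPolynomial.eval v (P i) / MvPolynomial.eval v (Q i)}) := by
  constructor
  · rintro ⟨p, q, hq, rfl⟩
    have key : ∀ (r : Polynomial ℝ) (v : Fin 2 → ℝ),
        MvPolynomial.eval v (Polynomial.aeval (MvPolynomial.X 0 : MvPolynomial (Fin 2) ℝ) r)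
          = r.eval (v 0) := by
      intro r v
      induction r using Polynomial.induction_on' with
      | add a b ha hb => simp [ha, hb]
      | monomial n a => simp [Polynomial.aeval_monomial, MvPolynomial.algebraMap_eq]
    refine ⟨fun i => Polynomial.aeval (MvPolynomial.X 0) (p i),
      fun i => Polynomial.aeval (MvPolynomial.X 0) (q i), ?_, ?_⟩
    · intro i v hv
      rw [key]
      exact hq i _ ⟨by nlinarith [sq_nonneg (v 1)], by nlinarith [sq_nonneg (v 1)]⟩
    · ext y
      simp only [Set.mem_ofPred_eq, key]
      constructor
      · rintro ⟨t, ⟨h1, h2⟩, h⟩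
        refine ⟨![t, Real.sqrt (1 - t ^ 2)], ?_, by simpa using h⟩
        have : 0 ≤ 1 - t ^ 2 := by nlinarith
        simp [Real.sq_sqrt this]
      · rintro ⟨v, hv, h⟩
        exact ⟨v 0, ⟨by nlinarith [sq_nonneg (v 1)], by nlinarith [sq_nonneg (v 1)]⟩, h⟩
  · rintro ⟨P, Q, hQ, rfl⟩
    let T : Polynomial ℝ := Polynomial.X
    let D : Polynomial ℝ := (1 + T ^ 2) ^ 2
    let N : Fin 2 → Polynomial ℝ :=
      ![(1 - T ^ 2) ^ 2 - (2 * T) ^ 2, 2 * (1 - T ^ 2) * (2 * T)]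
    have hDe : ∀ t : ℝ, D.eval t = (1 + t ^ 2) ^ 2 := fun t => by simp [D, T]
    have hN0 : ∀ t : ℝ, (N 0).eval t = (1 - t ^ 2) ^ 2 - (2 * t) ^ 2 := fun t => by
      simp [N, T]
    have hN1 : ∀ t : ℝ, (N 1).eval t = 2 * (1 - t ^ 2) * (2 * t) := fun t => by
      simp [N, T]
    have hD : ∀ t : ℝ, D.eval t ≠ 0 := fun t => by rw [hDe]; positivity
    have hc : ∀ t : ℝ, ((N 0).eval t / D.eval t) ^ 2 + ((N 1).eval t / D.eval t) ^ 2 = 1 := by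
      intro t
      have := hD t
      rw [div_pow, div_pow, ← add_div, div_eq_one_iff_eq (pow_ne_zero 2 this), hDe, hN0, hN1]
      ring
    choose p n hp using fun i => clear_denominators N D hD (P i)
    choose q k hq using fun i => clear_denominators N D hD (Q i)
    have hfrac : ∀ i t, (p i * D ^ k i).eval t / (q i * D ^ n i).eval t =
        MvPolynomial.eval (fun j => (N j).eval t / D.eval t) (P i) /
        MvPolynomial.eval (fun j => (N j).eval t / D.eval t) (Q i) := by
      intro i t
      have h0 := hD t
      have h1 := hQ i (fun j => (N j).eval t / D.eval t) (hc t)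
      simp only [Polynomial.eval_mul, Polynomial.eval_pow, hp, hq]
      rw [div_eq_div_iff (by positivity) h1]
      ring
    refine ⟨fun i => p i * D ^ k i, fun i => q i * D ^ n i, ?_, ?_⟩
    · intro i t _
      simp only [Polynomial.eval_mul, Polynomial.eval_pow, hq]
      exact mul_ne_zero (mul_ne_zero (pow_ne_zero _ (hD t)) (hQ i _ (hc t)))
        (pow_ne_zero _ (hD t))
    · ext y
      simp only [Set.mem_ofPred_eq, hfrac]
      constructor
      · rintro ⟨v, hv, h⟩
        obtain ⟨t, ht, hx, hy⟩ := circle_param _ _ hv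
        refine ⟨t, ht, ?_⟩
        have : (fun j => (N j).eval t / D.eval t) = v := by
          funext j
          fin_cases j
          · change (N 0).eval t / D.eval t = v 0
            rw [hN0, hDe, hx]
          · change (N 1).eval t / D.eval t = v 1
            rw [hN1, hDe, hy]
        rw [this]
        exact h
      · rintro ⟨t, _, h⟩
        exact ⟨_, hc t, h⟩
end

section
/- If S ⊆ ℝ^m is the image of the closed unit ball B̄_n under a polynomial map f : ℝⁿ → ℝ^m, then S is the image of the unit sphere 𝕊ⁿ ⊆ ℝ^{n+1} under a polynomial map g : ℝ^{n+1} → ℝ^m. -/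
/-- If `S ⊆ ℝ^m` is the image of the closed unit ball `B̄_n` under a
polynomial map `f : ℝⁿ → ℝ^m`, then `S` is the image of the unit sphere
`𝕊ⁿ ⊆ ℝ^{n+1}` under a polynomial map `g : ℝ^{n+1} → ℝ^m`. -/
theorem polynomial_image_closedBall_is_polynomial_image_sphere
    (n m : ℕ) (S : Set (Fin m → ℝ))
    (f : EuclideanSpace ℝ (Fin n) → (Fin m → ℝ))
    (hf : ∃ F : Fin m → MvPolynomial (Fin n) ℝ,
      ∀ x i, f x i = MvPolynomial.eval x (F i))
    (hS : S = f '' Metric.closedBall (0 : EuclideanSpace ℝ (Fin n)) 1) :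
    ∃ g : EuclideanSpace ℝ (Fin (n + 1)) → (Fin m → ℝ),
      (∃ G : Fin m → MvPolynomial (Fin (n + 1)) ℝ,
        ∀ x i, g x i = MvPolynomial.eval x (G i)) ∧
      S = g '' Metric.sphere (0 : EuclideanSpace ℝ (Fin (n + 1))) 1 := by
  obtain ⟨F, hF⟩ := hf
  refine ⟨fun x => f (WithLp.toLp 2 (fun j => x j.castSucc)),
    ⟨fun i => MvPolynomial.rename Fin.castSucc (F i), ?_⟩, ?_⟩
  · intro x i
    rw [MvPolynomial.eval_rename]
    exact hF _ i
  · rw [hS]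
    ext y
    simp only [Set.mem_image]
    constructor
    · rintro ⟨x, hx, rfl⟩
      have hx1 : ‖x‖ ≤ 1 := by simpa using hx
      have hx2 : ∑ i, x i ^ 2 ≤ 1 := by
        rw [← EuclideanSpace.real_norm_sq_eq]
        nlinarith [norm_nonneg x]
      refine ⟨WithLp.toLp 2 (Fin.snoc (α := fun _ => ℝ) (fun j => x j)
        (Real.sqrt (1 - ∑ i, x i ^ 2))), ?_, ?_⟩
      · rw [mem_sphere_zero_iff_norm, ← sq_eq_sq₀ (norm_nonneg _) zero_le_one,
          EuclideanSpace.real_norm_sq_eq, Fin.sum_univ_castSucc]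
        simp only [Fin.snoc_castSucc, Fin.snoc_last]
        rw [Real.sq_sqrt (by linarith)]
        ring
      · congr 1
        ext j
        simp
    · rintro ⟨x, hx, rfl⟩
      refine ⟨_, ?_, rfl⟩
      have hx1 : ‖x‖ ^ 2 = 1 := by
        rw [mem_sphere_zero_iff_norm.mp hx]; norm_num
      rw [EuclideanSpace.real_norm_sq_eq, Fin.sum_univ_castSucc] at hx1
      rw [mem_closedBall_zero_iff, ← sq_le_sq₀ (norm_nonneg _) zero_le_one,
        EuclideanSpace.real_norm_sq_eq]
      simp only
      nlinarith [sq_nonneg (x (Fin.last n))]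
end

section
/- The regular map f : ℝ → ℝ² defined by f(t) = ( (2t/(t²+1))² − ((t²−1)/(t²+1))² , 2·(2t/(t²+1))·((t²−1)/(t²+1)) ) maps the interval [−1,1] onto the unit circle, i.e., f([−1,1]) = 𝕊¹. -/
/-- The regular map
`f(t) = ((2t/(t²+1))² − ((t²−1)/(t²+1))², 2·(2t/(t²+1))·((t²−1)/(t²+1)))`
maps `[-1,1]` onto the unit circle `𝕊¹`. -/
theorem regular_map_Icc_onto_circle :
    (fun t : ℝ =>
      ((2 * t / (t ^ 2 + 1)) ^ 2 - ((t ^ 2 - 1) / (t ^ 2 + 1)) ^ 2,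
        2 * (2 * t / (t ^ 2 + 1)) * ((t ^ 2 - 1) / (t ^ 2 + 1)))) ''
        Set.Icc (-1 : ℝ) 1 =
      {p : ℝ × ℝ | p.1 ^ 2 + p.2 ^ 2 = 1} := by
  ext ⟨x, y⟩
  simp only [Set.mem_image, Set.mem_Icc, Set.mem_setOf_eq, Prod.mk.injEq]
  constructor
  · rintro ⟨t, -, rfl, rfl⟩
    have h : t ^ 2 + 1 ≠ 0 := by positivity
    field_simp
    ring
  · intro h
    have hx1 : 0 ≤ (1 + x) / 2 := by nlinarith [sq_nonneg y]
    have hx2 : 0 ≤ (1 - x) / 2 := by nlinarith [sq_nonneg y]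
    have key : ∃ u b : ℝ, 0 ≤ b ∧ u ^ 2 = (1 + x) / 2 ∧ b ^ 2 = (1 - x) / 2 ∧ y = -(2 * u * b) := by
      have ha := Real.sq_sqrt hx1
      have hb := Real.sq_sqrt hx2
      have hb0 := Real.sqrt_nonneg ((1 - x) / 2)
      generalize √((1 + x) / 2) = a at *
      generalize √((1 - x) / 2) = b at *
      have hy : y ^ 2 = (2 * a * b) ^ 2 := by
        have : (2 * a * b) ^ 2 = 4 * a ^ 2 * b ^ 2 := by ring
        rw [this, ha, hb]
        linarith
      rcases sq_eq_sq_iff_eq_or_eq_neg.mp hy with h1 | h1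
      · exact ⟨-a, b, hb0, by rw [neg_sq, ha], hb, by rw [h1]; ring⟩
      · exact ⟨a, b, hb0, ha, hb, h1⟩
    obtain ⟨u, b, hb0, hu, hb, hy⟩ := key
    have hp : 0 < 1 + b := by linarith
    have hub : u ^ 2 = 1 - b ^ 2 := by linarith
    have e0 : (u / (1 + b)) ^ 2 = (1 - b) / (1 + b) := by
      rw [div_pow, hub]
      field_simp
      ring
    have e3 : (u / (1 + b)) ^ 2 + 1 = 2 / (1 + b) := by
      rw [e0]
      field_simp
      ring
    have e1 : 2 * (u / (1 + b)) / ((u / (1 + b)) ^ 2 + 1) = u := by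
      rw [e3]
      field_simp
    have e2 : ((u / (1 + b)) ^ 2 - 1) / ((u / (1 + b)) ^ 2 + 1) = -b := by
      rw [e3, e0]
      field_simp
      ring
    refine ⟨u / (1 + b), ?_, ?_, ?_⟩
    · apply abs_le.mp
      apply abs_le_one_iff_mul_self_le_one.mpr
      rw [← sq, e0, div_le_one hp]
      linarith
    · rw [e1, e2]
      linarith
    · rw [e1, e2, hy]
      ring
end

section
/- Let f : ℝ → ℝ² be the map f(t) = ( (2t/(t²+1))² − ((t²−1)/(t²+1))² , 2·(2t/(t²+1))·((t²−1)/(t²+1)) ). Then f(t) ≠ (0,0) for every t ∈ [−1,1], and the induced map from [−1,1] to the real projective line ℙ(ℝ²) sending t to the projective class of f(t) is surjective. In particular, the real projective line is a regular image of [−1,1]. -/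
/-- The regular map `f : ℝ → ℝ²` of Example 2.2 in the paper. -/
noncomputable def exampleMap (t : ℝ) : ℝ × ℝ :=
  ((2 * t / (t ^ 2 + 1)) ^ 2 - ((t ^ 2 - 1) / (t ^ 2 + 1)) ^ 2,
    2 * (2 * t / (t ^ 2 + 1)) * ((t ^ 2 - 1) / (t ^ 2 + 1)))

theorem exampleMap_norm (t : ℝ) : (exampleMap t).1 ^ 2 + (exampleMap t).2 ^ 2 = 1 := by
  have h : t ^ 2 + 1 ≠ 0 := by positivity
  simp only [exampleMap]
  field_simp
  ring

theorem exampleMap_ne (t : ℝ) : exampleMap t ≠ 0 := by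
  intro h
  have := exampleMap_norm t
  simp [h] at this

theorem exampleMap_continuous : Continuous exampleMap := by
  have h : ∀ t : ℝ, t ^ 2 + 1 ≠ 0 := fun t => by positivity
  unfold exampleMap
  fun_prop (disch := exact h _)

/-- `f(t) ≠ (0,0)` for `t ∈ [-1,1]`, and the induced map
`[-1,1] → ℙ(ℝ²)` sending `t` to the projective class of `f(t)` is surjective; in
particular, the real projective line is a regular image of `[-1,1]`. -/
theorem projective_line_regular_image_of_Icc :
    (∀ t ∈ Set.Icc (-1 : ℝ) 1, exampleMap t ≠ (0, 0)) ∧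
    ∀ P : Projectivization ℝ (ℝ × ℝ),
      ∃ t, ∃ _ : t ∈ Set.Icc (-1 : ℝ) 1, ∃ h : exampleMap t ≠ 0,
        Projectivization.mk ℝ (exampleMap t) h = P := by
  refine ⟨fun t _ => exampleMap_ne t, fun P => ?_⟩
  induction P using Projectivization.ind with
  | h v hv =>
    obtain ⟨a, b⟩ := v
    have hc : ContinuousOn (fun t => a * (exampleMap t).2 - b * (exampleMap t).1)
        (Set.uIcc (-1 : ℝ) 0) := by
      exact ((continuous_const.mul exampleMap_continuous.snd).sub
        (continuous_const.mul exampleMap_continuous.fst)).continuousOn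
    have h0 : (0 : ℝ) ∈ Set.uIcc (a * (exampleMap (-1)).2 - b * (exampleMap (-1)).1)
        (a * (exampleMap 0).2 - b * (exampleMap 0).1) := by
      norm_num [exampleMap, Set.mem_uIcc]
      exact (le_total 0 b).symm.imp id id |>.symm
    obtain ⟨t, ht, hz⟩ := intermediate_value_uIcc hc h0
    rw [Set.uIcc_of_le (by norm_num)] at ht
    refine ⟨t, ⟨ht.1, ht.2.trans zero_le_one⟩, exampleMap_ne t, ?_⟩
    symm
    rw [Projectivization.mk_eq_mk_iff']
    have hn := exampleMap_norm t
    refine ⟨a * (exampleMap t).1 + b * (exampleMap t).2, ?_⟩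
    simp only at hz
    ext
    · simp only [Prod.smul_fst, smul_eq_mul]
      linear_combination a * hn - (exampleMap t).2 * hz
    · simp only [Prod.smul_snd, smul_eq_mul]
      linear_combination b * hn + (exampleMap t).1 * hz
end

section
/- Every regulous function on ℝ is regular: let f : ℝ → ℝ be a continuous function and let p, q be polynomials with real coefficients in one variable with q ≠ 0 such that f(x) = p(x)/q(x) for every x ∈ ℝ with q(x) ≠ 0. Then there exist polynomials p', q' with real coefficients in one variable such that q'(x) ≠ 0 for all x ∈ ℝ and f(x) = p'(x)/q'(x) for all x ∈ ℝ. -/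
/-- Every regulous function on `ℝ` is regular: a continuous function on
`ℝ` that agrees with a rational function `p/q` wherever `q ≠ 0` can be written as a
quotient of polynomials whose denominator vanishes nowhere on `ℝ`. -/
theorem regulous_on_R_is_regular
    (f : ℝ → ℝ) (hf : Continuous f)
    (p q : Polynomial ℝ) (hq : q ≠ 0)
    (hpq : ∀ x : ℝ, q.eval x ≠ 0 → f x = p.eval x / q.eval x) :
    ∃ p' q' : Polynomial ℝ,
      (∀ x : ℝ, q'.eval x ≠ 0) ∧ ∀ x : ℝ, f x = p'.eval x / q'.eval x := by
  classical
  obtain ⟨a, b, hab⟩ : IsCoprime (p / GCDMonoid.gcd p q) (q / GCDMonoid.gcd p q) :=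
    isCoprime_div_gcd_div_gcd hq
  have hp1 := EuclideanDomain.mul_div_cancel' (show GCDMonoid.gcd p q ≠ 0 from
    fun h => hq ((gcd_eq_zero_iff _ _).1 h).2) (gcd_dvd_left p q)
  have hq1 := EuclideanDomain.mul_div_cancel' (show GCDMonoid.gcd p q ≠ 0 from
    fun h => hq ((gcd_eq_zero_iff _ _).1 h).2) (gcd_dvd_right p q)
  generalize p / GCDMonoid.gcd p q = p' at *
  generalize q / GCDMonoid.gcd p q = q' at *
  generalize GCDMonoid.gcd p q = g at *
  have hd : Dense {x : ℝ | q.IsRoot x}ᶜ :=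
    (Polynomial.finite_setOfPred_isRoot hq).countable.dense_compl ℝ
  have key : (fun x => f x * q'.eval x) = fun x => p'.eval x := by
    refine Continuous.ext_on hd (hf.mul q'.continuous) p'.continuous ?_
    intro x hx
    have hx' : q.eval x ≠ 0 := hx
    have h1 := hpq x hx'
    rw [← hp1, ← hq1, Polynomial.eval_mul, Polynomial.eval_mul] at h1
    rw [← hq1, Polynomial.eval_mul] at hx'
    have hg := left_ne_zero_of_mul hx'
    have hb := right_ne_zero_of_mul hx'
    simp only [h1]
    field_simp
  have hne : ∀ x : ℝ, q'.eval x ≠ 0 := by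
    intro x hx
    have h1 := congrFun key x
    have h2 := congrArg (Polynomial.eval x) hab
    simp only [hx, mul_zero] at h1
    simp [hx, ← h1] at h2
  exact ⟨p', q', hne, fun x => (eq_div_iff (hne x)).2 (congrFun key x)⟩
end

section
/- Let p₀, p₁ be coprime polynomials with real coefficients in one variable, not both constant, let b ∈ ℂ with b ∉ ℝ, and let P ≥ 1 be an integer. View p₀, p₁ as polynomials with complex coefficients via the embedding ℝ ↪ ℂ, and suppose that the product (p₁ − b·p₀)·(p₁ − conj(b)·p₀) divides (1 + X²)^P in ℂ[X]. Then there exist an integer k ≥ 1 and λ ∈ ℂ ∖ {0} such that either p₁ − b·p₀ = λ·(1 + iX)^k and p₁ − conj(b)·p₀ = conj(λ)·(1 − iX)^k, or p₁ − b·p₀ = λ·(1 − iX)^k and p₁ − conj(b)·p₀ = conj(λ)·(1 + iX)^k. -/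
open Polynomial

theorem aux_prime (c : ℂ) (hc : c ≠ 0) : Prime (1 + C c * X : Polynomial ℂ) := by
  apply Polynomial.prime_of_degree_eq_one
  rw [add_comm]
  exact degree_linear hc

theorem aux_case (u v A B : Polynomial ℂ) (hu : Prime u) (hv : Prime v)
    (huv : u.map (starRingEnd ℂ) = v)
    (hB : A.map (starRingEnd ℂ) = B) (hco : IsCoprime A B) (P : ℕ)
    (hd : A ∣ u ^ P * v ^ P) (huA : u ∣ A) :
    ∃ k : ℕ, 1 ≤ k ∧ ∃ l : ℂ, l ≠ 0 ∧ A = C l * u ^ k ∧ B = C ((starRingEnd ℂ) l) * v ^ k := by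
  have hvB : v ∣ B := by
    rw [← huv, ← hB]
    exact Polynomial.map_dvd _ huA
  have hvA : ¬ v ∣ A := fun h => hv.not_isUnit (hco.isUnit_of_dvd' h hvB)
  have h1 : IsCoprime A (v ^ P) :=
    (((hv.irreducible.coprime_iff_not_dvd).2 hvA).symm).pow_right
  have h2 : A ∣ u ^ P := h1.dvd_of_dvd_mul_right hd
  obtain ⟨k, -, hk⟩ := (dvd_prime_pow hu P).1 h2
  obtain ⟨w, hw⟩ := hk.symm
  obtain ⟨l, hl, hlw⟩ := Polynomial.isUnit_iff.1 w.isUnit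
  have hA : A = C l * u ^ k := by rw [← hw, hlw, mul_comm]
  refine ⟨k, ?_, l, hl.ne_zero, hA, ?_⟩
  · rcases Nat.eq_zero_or_pos k with h | h
    · exfalso
      apply hu.not_isUnit
      apply isUnit_of_dvd_unit huA
      rw [hA, h, pow_zero, mul_one]
      exact Polynomial.isUnit_C.2 hl
    · exact h
  · rw [← hB, hA, Polynomial.map_mul, Polynomial.map_pow, Polynomial.map_C, huv]

/-- If `p₀, p₁ ∈ ℝ[X]` are coprime, not both constant, `b ∈ ℂ ∖ ℝ` and
`(p₁ − b·p₀)(p₁ − conj(b)·p₀)` divides `(1 + X²)^P` in `ℂ[X]` with `P ≥ 1`, then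
`p₁ − b·p₀` and `p₁ − conj(b)·p₀` are, up to conjugated nonzero constants, conjugated
powers `(1 ± iX)^k` with `k ≥ 1`. -/
theorem coprime_divisor_of_one_add_sq_pow
    (p₀ p₁ : Polynomial ℝ) (hcop : IsCoprime p₀ p₁)
    (hnc : ¬(p₀.natDegree = 0 ∧ p₁.natDegree = 0))
    (b : ℂ) (hb : ¬∃ r : ℝ, (r : ℂ) = b)
    (P : ℕ) (hP : 1 ≤ P)
    (hdvd : ((p₁.map (algebraMap ℝ ℂ) - C b * p₀.map (algebraMap ℝ ℂ)) *
        (p₁.map (algebraMap ℝ ℂ) - C ((starRingEnd ℂ) b) * p₀.map (algebraMap ℝ ℂ))) ∣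
      (1 + X ^ 2 : Polynomial ℂ) ^ P) :
    ∃ (k : ℕ), 1 ≤ k ∧ ∃ l : ℂ, l ≠ 0 ∧
      ((p₁.map (algebraMap ℝ ℂ) - C b * p₀.map (algebraMap ℝ ℂ) =
          C l * (1 + C Complex.I * X) ^ k ∧
        p₁.map (algebraMap ℝ ℂ) - C ((starRingEnd ℂ) b) * p₀.map (algebraMap ℝ ℂ) =
          C ((starRingEnd ℂ) l) * (1 - C Complex.I * X) ^ k) ∨
       (p₁.map (algebraMap ℝ ℂ) - C b * p₀.map (algebraMap ℝ ℂ) =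
          C l * (1 - C Complex.I * X) ^ k ∧
        p₁.map (algebraMap ℝ ℂ) - C ((starRingEnd ℂ) b) * p₀.map (algebraMap ℝ ℂ) =
          C ((starRingEnd ℂ) l) * (1 + C Complex.I * X) ^ k)) := by
  have hd : b - (starRingEnd ℂ) b ≠ 0 := by
    intro h
    apply hb
    obtain ⟨r, hr⟩ := Complex.conj_eq_iff_real.1 (sub_eq_zero.1 h).symm
    exact ⟨r, hr.symm⟩
  have hconj : ∀ p : Polynomial ℝ, (p.map (algebraMap ℝ ℂ)).map (starRingEnd ℂ)
      = p.map (algebraMap ℝ ℂ) := by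
    intro p
    ext n
    simp
  set q₀ := p₀.map (algebraMap ℝ ℂ) with hq₀
  set q₁ := p₁.map (algebraMap ℝ ℂ) with hq₁
  have hB : (q₁ - C b * q₀).map (starRingEnd ℂ) = q₁ - C ((starRingEnd ℂ) b) * q₀ := by
    rw [Polynomial.map_sub, Polynomial.map_mul, Polynomial.map_C, hconj, hconj]
  have hdC : (C (b - (starRingEnd ℂ) b)⁻¹ : Polynomial ℂ) * (C b - C ((starRingEnd ℂ) b)) = 1 := by
    rw [← C_sub, ← C_mul, inv_mul_cancel₀ hd, C_1]
  have hco : IsCoprime (q₁ - C b * q₀) (q₁ - C ((starRingEnd ℂ) b) * q₀) := by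
    have h := hcop.map (Polynomial.mapRingHom (algebraMap ℝ ℂ))
    simp only [Polynomial.coe_mapRingHom] at h
    obtain ⟨a, c, hac⟩ := h
    rw [← hq₀, ← hq₁] at hac
    refine ⟨c - (a + c * C b) * C (b - (starRingEnd ℂ) b)⁻¹,
      (a + c * C b) * C (b - (starRingEnd ℂ) b)⁻¹, ?_⟩
    linear_combination hac + (a + c * C b) * q₀ * hdC
  have hI : (1 - C Complex.I * X : Polynomial ℂ) = 1 + C (-Complex.I) * X := by
    rw [C_neg]; ring
  have hu : Prime (1 + C Complex.I * X : Polynomial ℂ) := aux_prime _ Complex.I_ne_zero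
  have hv : Prime (1 - C Complex.I * X : Polynomial ℂ) := by
    rw [hI]; exact aux_prime _ (neg_ne_zero.2 Complex.I_ne_zero)
  have huv : (1 + C Complex.I * X : Polynomial ℂ).map (starRingEnd ℂ) = 1 - C Complex.I * X := by
    simp [sub_eq_add_neg]
  have hvu : (1 - C Complex.I * X : Polynomial ℂ).map (starRingEnd ℂ) = 1 + C Complex.I * X := by
    simp
  have hII : (C Complex.I * C Complex.I : Polynomial ℂ) = -1 := by
    rw [← C_mul, Complex.I_mul_I, C_neg, C_1]
  have hfac : (1 + X ^ 2 : Polynomial ℂ) = (1 + C Complex.I * X) * (1 - C Complex.I * X) := by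
    linear_combination X ^ 2 * hII
  have hA := dvd_of_mul_right_dvd hdvd
  rw [hfac, mul_pow] at hA
  by_cases h1 : (1 + C Complex.I * X : Polynomial ℂ) ∣ q₁ - C b * q₀
  · obtain ⟨k, hk, l, hl, e1, e2⟩ := aux_case _ _ _ _ hu hv huv hB hco P hA h1
    exact ⟨k, hk, l, hl, Or.inl ⟨e1, e2⟩⟩
  by_cases h2 : (1 - C Complex.I * X : Polynomial ℂ) ∣ q₁ - C b * q₀
  · rw [mul_comm ((1 + C Complex.I * X : Polynomial ℂ) ^ P)] at hA
    obtain ⟨k, hk, l, hl, e1, e2⟩ := aux_case _ _ _ _ hv hu hvu hB hco P hA h2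
    exact ⟨k, hk, l, hl, Or.inr ⟨e1, e2⟩⟩
  exfalso
  have c1 : IsCoprime (q₁ - C b * q₀) ((1 + C Complex.I * X) ^ P) :=
    (((hu.irreducible.coprime_iff_not_dvd).2 h1).symm).pow_right
  have c2 : IsCoprime (q₁ - C b * q₀) ((1 - C Complex.I * X) ^ P) :=
    (((hv.irreducible.coprime_iff_not_dvd).2 h2).symm).pow_right
  have hunit : IsUnit (q₁ - C b * q₀) := (c1.mul_right c2).isUnit_of_dvd' dvd_rfl hA
  obtain ⟨l, hl, hlA⟩ := Polynomial.isUnit_iff.1 hunit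
  have hlB : q₁ - C ((starRingEnd ℂ) b) * q₀ = C ((starRingEnd ℂ) l) := by
    rw [← hB, ← hlA, Polynomial.map_C]
  have e0 : q₀ = C ((b - (starRingEnd ℂ) b)⁻¹ * ((starRingEnd ℂ) l - l)) := by
    rw [C_mul, C_sub]
    linear_combination (-q₀) * hdC +
      C (b - (starRingEnd ℂ) b)⁻¹ * (hlB + hlA)
  have e1 : q₁ = C (l + b * ((b - (starRingEnd ℂ) b)⁻¹ * ((starRingEnd ℂ) l - l))) := by
    rw [C_add, C_mul, ← e0]
    linear_combination -hlA
  apply hnc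
  constructor
  · rw [← Polynomial.natDegree_map (algebraMap ℝ ℂ), ← hq₀, e0, natDegree_C]
  · rw [← Polynomial.natDegree_map (algebraMap ℝ ℂ), ← hq₁, e1, natDegree_C]
end

section
/- Let p₀, p₁ be coprime polynomials with real coefficients in one variable, let c ∈ ℝ with c ≠ 0 and let P ≥ 1 be an integer such that p₀² + p₁² = c·(1 + X²)^P in ℝ[X]. View p₀, p₁ as polynomials with complex coefficients via the embedding ℝ ↪ ℂ. Then there exists λ ∈ ℂ ∖ {0} such that either p₁ − i·p₀ = λ·(1 + iX)^P or p₁ − i·p₀ = λ·(1 − iX)^P in ℂ[X]. -/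
open Polynomial

lemma aux_unit (A B U V : ℂ[X]) (P : ℕ) (c : ℂ) (hc : c ≠ 0) (hU : U ≠ 0) (hV : V ≠ 0)
    (h : A * B = C c * (U * V) ^ P) (hA : U ^ P ∣ A) (hB : V ^ P ∣ B) :
    ∃ l : ℂ, l ≠ 0 ∧ A = C l * U ^ P := by
  obtain ⟨a, rfl⟩ := hA
  obtain ⟨b, rfl⟩ := hB
  have h0 : (U * V) ^ P ≠ 0 := pow_ne_zero _ (mul_ne_zero hU hV)
  have hab : a * b = C c := by
    apply mul_right_cancel₀ h0
    rw [← h]; ring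
  have hu : IsUnit a := by
    apply isUnit_of_mul_isUnit_left (y := b)
    rw [hab]
    exact isUnit_C.2 (isUnit_iff_ne_zero.2 hc)
  obtain ⟨l, hl, rfl⟩ := Polynomial.isUnit_iff.1 hu
  exact ⟨l, hl.ne_zero, mul_comm _ _⟩

/-- If `p₀, p₁ ∈ ℝ[X]` are coprime and `p₀² + p₁² = c·(1 + X²)^P` with
`c ≠ 0` and `P ≥ 1`, then in `ℂ[X]` the factor `p₁ − i·p₀` is a nonzero constant times
either `(1 + iX)^P` or `(1 − iX)^P`. -/
theorem sum_sq_eq_one_add_sq_pow_factor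
    (p₀ p₁ : Polynomial ℝ) (hcop : IsCoprime p₀ p₁)
    (c : ℝ) (hc : c ≠ 0) (P : ℕ) (hP : 1 ≤ P)
    (heq : p₀ ^ 2 + p₁ ^ 2 = C c * (1 + X ^ 2) ^ P) :
    ∃ l : ℂ, l ≠ 0 ∧
      (p₁.map (algebraMap ℝ ℂ) - C Complex.I * p₀.map (algebraMap ℝ ℂ) =
          C l * (1 + C Complex.I * X) ^ P ∨
        p₁.map (algebraMap ℝ ℂ) - C Complex.I * p₀.map (algebraMap ℝ ℂ) =
          C l * (1 - C Complex.I * X) ^ P) := by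
  have hII : (C Complex.I : ℂ[X]) * C Complex.I = -1 := by
    rw [← C_mul, Complex.I_mul_I]; simp
  have hconj (p : ℝ[X]) : (p.map (algebraMap ℝ ℂ)).map (starRingEnd ℂ)
      = p.map (algebraMap ℝ ℂ) := by
    rw [Polynomial.map_map]
    congr 1
    ext x
    simp
  have heq' := congrArg (Polynomial.map (algebraMap ℝ ℂ)) heq
  obtain ⟨u, v, huv⟩ := hcop
  have huv' := congrArg (Polynomial.map (algebraMap ℝ ℂ)) huv
  simp only [Polynomial.map_add, Polynomial.map_mul, Polynomial.map_pow, Polynomial.map_one,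
    Polynomial.map_X, Polynomial.map_C] at heq' huv'
  have hq0 := hconj p₀
  have hq1 := hconj p₁
  generalize p₀.map (algebraMap ℝ ℂ) = q₀ at *
  generalize p₁.map (algebraMap ℝ ℂ) = q₁ at *
  generalize u.map (algebraMap ℝ ℂ) = u' at *
  generalize v.map (algebraMap ℝ ℂ) = v' at *
  have hc' : (algebraMap ℝ ℂ c) ≠ 0 := by simpa using hc
  have hAB : (q₁ - C Complex.I * q₀) * (q₁ + C Complex.I * q₀)
      = C (algebraMap ℝ ℂ c) * ((1 + C Complex.I * X) * (1 - C Complex.I * X)) ^ P := by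
    have e1 : (1 + C Complex.I * X) * (1 - C Complex.I * X) = (1 + X ^ 2 : ℂ[X]) := by
      linear_combination (-X ^ 2) * hII
    rw [e1, ← heq']
    linear_combination (-q₀ ^ 2) * hII
  have hUdeg : (1 + C Complex.I * X : ℂ[X]).degree = 1 := by
    rw [add_comm, ← C_1]; exact degree_linear Complex.I_ne_zero
  have hUp : Prime (1 + C Complex.I * X : ℂ[X]) := prime_of_degree_eq_one hUdeg
  have hUV : (1 + C Complex.I * X : ℂ[X]).map (starRingEnd ℂ) = 1 - C Complex.I * X := by
    simp [sub_eq_add_neg]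
  have hV0 : (1 - C Complex.I * X : ℂ[X]) ≠ 0 := by
    rw [← hUV]
    exact (Polynomial.map_ne_zero_iff (starRingEnd ℂ).injective).2 hUp.ne_zero
  have hA : (q₁ - C Complex.I * q₀).map (starRingEnd ℂ) = q₁ + C Complex.I * q₀ := by
    simp [hq0, hq1]
  have hB : (q₁ + C Complex.I * q₀).map (starRingEnd ℂ) = q₁ - C Complex.I * q₀ := by
    simp [hq0, hq1, sub_eq_add_neg]
  have h2 : (C (1/2 : ℂ) : ℂ[X]) * 2 = 1 := by
    rw [← C_ofNat, ← C_mul]; norm_num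
  have hco : IsCoprime (q₁ - C Complex.I * q₀) (q₁ + C Complex.I * q₀) := by
    refine ⟨C (1/2) * (v' + C Complex.I * u'), C (1/2) * (v' - C Complex.I * u'), ?_⟩
    linear_combination (-2 * C (1/2) * u' * q₀) * hII + h2 + 2 * C (1/2) * huv'
  have hdvd : (1 + C Complex.I * X : ℂ[X]) ^ P ∣
      (q₁ - C Complex.I * q₀) * (q₁ + C Complex.I * q₀) := by
    rw [hAB, mul_pow]
    exact Dvd.intro_left (C (algebraMap ℝ ℂ c) * (1 - C Complex.I * X) ^ P) (by ring)
  have key : (1 + C Complex.I * X : ℂ[X]) ^ P ∣ (q₁ - C Complex.I * q₀) ∨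
      (1 + C Complex.I * X : ℂ[X]) ^ P ∣ (q₁ + C Complex.I * q₀) := by
    by_cases h : (1 + C Complex.I * X : ℂ[X]) ∣ (q₁ - C Complex.I * q₀)
    · left
      refine hUp.pow_dvd_of_dvd_mul_right P (fun h' => ?_) hdvd
      exact hUp.not_unit (hco.isUnit_of_dvd' h h')
    · right
      exact hUp.pow_dvd_of_dvd_mul_left P h hdvd
  rcases key with h | h
  · have h' := Polynomial.map_dvd (starRingEnd ℂ) h
    rw [Polynomial.map_pow, hUV, hA] at h'
    obtain ⟨l, hl, e⟩ := aux_unit _ _ _ _ P _ hc' hUp.ne_zero hV0 hAB h h'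
    exact ⟨l, hl, Or.inl e⟩
  · have h' := Polynomial.map_dvd (starRingEnd ℂ) h
    rw [Polynomial.map_pow, hUV, hB] at h'
    rw [mul_comm (1 + C Complex.I * X)] at hAB
    obtain ⟨l, hl, e⟩ := aux_unit _ _ _ _ P _ hc' hV0 hUp.ne_zero hAB h' h
    exact ⟨l, hl, Or.inr e⟩
end
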